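/- Let N ≥ 2 and let i ≠ j in Fin N. Let P = I − (1/2)(e_i − e_j)(e_i − e_j)ᵀ ∈ Matrix (Fin N) (Fin N) ℝ, where e_i is the i-th standard basis vector, and let J be the N×N all-ones matrix. Then: (i) P² = P; (ii) P is symmetric; (iii) P·𝟙 = 𝟙 and 𝟙ᵀP = 𝟙ᵀ, where 𝟙 is the all-ones vector; (iv) P·((1/4)(I − (1/N)J))·P + (1/4)(I − P) = (1/4)(I − (1/N)J). -/

import Mathlib

open Matrix

/-- The gossip averaging matrix `P = I − (1/2)(eᵢ − eⱼ)(eᵢ − eⱼ)ᵀ`. -/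
noncomputable def gossipP (N : ℕ) (i j : Fin N) : Matrix (Fin N) (Fin N) ℝ :=
  1 - ((1:ℝ)/2) • vecMulVec (Pi.single i 1 - Pi.single j 1) (Pi.single i 1 - Pi.single j 1)

/-- The gossip matrix is idempotent. -/
theorem gossipP_mul_self {N : ℕ} {i j : Fin N} (hij : i ≠ j) :
    gossipP N i j * gossipP N i j = gossipP N i j := by
  have hdot : (Pi.single i 1 - Pi.single j 1 : Fin N → ℝ) ⬝ᵥ
      (Pi.single i 1 - Pi.single j 1) = 2 := by
    simp [hij, hij.symm]
    norm_num
  simp only [gossipP, sub_mul, mul_sub, one_mul, mul_one, smul_mul_assoc, mul_smul_comm,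
    vecMulVec_mul_vecMulVec, hdot, vecMulVec_smul, smul_smul]
  module

/-- The gossip matrix is symmetric. -/
theorem gossipP_transpose {N : ℕ} (i j : Fin N) : (gossipP N i j)ᵀ = gossipP N i j := by
  simp [gossipP, transpose_vecMulVec]

/-- The gossip matrix fixes constant vectors. -/
theorem gossipP_mulVec_one {N : ℕ} (i j : Fin N) :
    gossipP N i j *ᵥ (fun _ => (1 : ℝ)) = fun _ => 1 := by
  have hdot : (Pi.single i 1 - Pi.single j 1 : Fin N → ℝ) ⬝ᵥ (fun _ => (1 : ℝ)) = 0 := by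
    simp [sub_dotProduct]
  simp [gossipP, sub_mulVec, smul_mulVec, vecMulVec_mulVec, hdot]

/-- The gossip matrix fixes the all-ones matrix under left multiplication. -/
theorem gossipP_mul_of_one {N : ℕ} (i j : Fin N) :
    gossipP N i j * of (fun _ _ => (1 : ℝ)) = of fun _ _ => (1 : ℝ) := by
  ext a b
  exact congrFun (gossipP_mulVec_one i j) a

/-- The gossip matrix `P` is an idempotent, symmetric, doubly stochastic matrix, and
`Σ* = (1/4)(I − (1/N)J)` is a fixed point of `M ↦ PMP + (1/4)(I − P)`. -/
theorem stmt_12 {N : ℕ} (hN : 2 ≤ N) (i j : Fin N) (hij : i ≠ j) :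
    gossipP N i j * gossipP N i j = gossipP N i j ∧
    (gossipP N i j)ᵀ = gossipP N i j ∧
    (gossipP N i j) *ᵥ (fun _ => (1:ℝ)) = (fun _ => (1:ℝ)) ∧
    (fun _ => (1:ℝ)) ᵥ* (gossipP N i j) = (fun _ => (1:ℝ)) ∧
    gossipP N i j * (((1:ℝ)/4) • ((1 : Matrix (Fin N) (Fin N) ℝ)
        - (N : ℝ)⁻¹ • Matrix.of (fun _ _ => (1:ℝ)))) * gossipP N i j
      + ((1:ℝ)/4) • ((1 : Matrix (Fin N) (Fin N) ℝ) - gossipP N i j) =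
      ((1:ℝ)/4) • ((1 : Matrix (Fin N) (Fin N) ℝ)
        - (N : ℝ)⁻¹ • Matrix.of (fun _ _ => (1:ℝ))) := by
  have hvec : (fun _ => (1 : ℝ)) ᵥ* gossipP N i j = fun _ => 1 := by
    rw [← mulVec_transpose, gossipP_transpose, gossipP_mulVec_one]
  have hof : of (fun _ _ => (1 : ℝ)) * gossipP N i j = of fun _ _ => (1 : ℝ) := by
    ext a b
    exact congrFun hvec b
  refine ⟨gossipP_mul_self hij, gossipP_transpose i j, gossipP_mulVec_one i j, hvec, ?_⟩
  simp only [mul_smul_comm, smul_mul_assoc, mul_sub, sub_mul, mul_one, gossipP_mul_self hij,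
    gossipP_mul_of_one, hof]
  module
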